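/- For every integer n ≥ 2, every positive integer K, and every positive integer k satisfying n!·k ≤ K(K+1)(K+2)⋯(K+n-1), one has K(K+n-1) ≥ (n!·k)^{2/n} − (n−1)(n−2)/6. (Consequently every Dirichlet eigenvalue λ_k of the hemisphere S^n_+, which equals K(K+n-1) for the unique K with (K−1)^{\overline{n}}/n! < k ≤ K^{\overline{n}}/n!, satisfies λ_k ≥ (n!)^{2/n} k^{2/n} − (n−1)(n−2)/6.) -/

import Mathlib

/-- The sum over `i < n` of the products of `a + i` and `a + c - i`. -/
theorem sum_range_add_mul_add_sub (n : ℕ) (a c : ℝ) :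
    ∑ i ∈ Finset.range n, (a + i) * (a + (c - i)) =
      n * (a * (a + c)) + c * (n * (n - 1) / 2) - (n - 1) * n * (2 * n - 1) / 6 := by
  induction n with
  | zero => simp
  | succ m ih =>
    rw [Finset.sum_range_succ, ih]
    push_cast
    ring

/-- Pairing the factor `a + i` with `a + (n - 1 - i)` in the square of a rising factorial. -/
theorem sq_prod_range_add (n : ℕ) (a : ℝ) :
    (∏ i ∈ Finset.range n, (a + i)) ^ 2 =
      ∏ i ∈ Finset.range n, (a + i) * (a + ((n : ℝ) - 1 - i)) := by
  rw [Finset.prod_mul_distrib, sq]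
  congr 1
  rw [← Finset.prod_range_reflect]
  refine Finset.prod_congr rfl fun i hi => ?_
  have hin : 1 + i ≤ n := by
    have := Finset.mem_range.mp hi
    lia
  rw [Nat.sub_sub, Nat.cast_sub hin]
  push_cast
  ring

/-- The inequality of arithmetic and geometric means for a squared rising factorial. -/
theorem prod_range_add_rpow_le (n : ℕ) (hn : n ≠ 0) {a : ℝ} (ha : 0 ≤ a) :
    (∏ i ∈ Finset.range n, (a + i)) ^ ((2 : ℝ) / n) ≤
      a * (a + n - 1) + ((n : ℝ) - 1) * ((n : ℝ) - 2) / 6 := by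
  have hn' : (n : ℝ) ≠ 0 := Nat.cast_ne_zero.mpr hn
  have hfactor : ∀ i ∈ Finset.range n, 0 ≤ (a + i) * (a + ((n : ℝ) - 1 - i)) := by
    intro i hi
    have hin : (i : ℝ) + 1 ≤ n := by exact_mod_cast Finset.mem_range.mp hi
    exact mul_nonneg (by positivity) (by linarith)
  have hprod : 0 ≤ ∏ i ∈ Finset.range n, (a + (i : ℝ)) :=
    Finset.prod_nonneg fun i _ => by positivity
  calc (∏ i ∈ Finset.range n, (a + i)) ^ ((2 : ℝ) / n)
      = ((∏ i ∈ Finset.range n, (a + i)) ^ 2) ^ ((1 : ℝ) / n) := by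
        rw [← Real.rpow_natCast_mul hprod]
        congr 1
        push_cast
        ring
    _ = ∏ i ∈ Finset.range n, ((a + i) * (a + ((n : ℝ) - 1 - i))) ^ ((1 : ℝ) / n) := by
        rw [sq_prod_range_add, Real.finsetProd_rpow _ _ hfactor]
    _ ≤ ∑ i ∈ Finset.range n, (1 : ℝ) / n * ((a + i) * (a + ((n : ℝ) - 1 - i))) :=
        Real.geom_mean_le_arith_mean_weighted _ (fun _ => (1 : ℝ) / n) _
          (fun _ _ => by positivity) (by simp [hn']) hfactor
    _ = a * (a + n - 1) + ((n : ℝ) - 1) * ((n : ℝ) - 2) / 6 := by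
        rw [← Finset.mul_sum, sum_range_add_mul_add_sub]
        field_simp
        ring

/-- Lower bound for Dirichlet eigenvalues of the hemisphere `S^n_+`: if `n ≥ 2`,
`K ≥ 1`, `k ≥ 1` and `n!·k ≤ K^{\overline{n}}`, then
`K(K+n-1) ≥ (n!·k)^{2/n} − (n−1)(n−2)/6`. -/
theorem stmt6 (n : ℕ) (hn : 2 ≤ n) (K : ℕ) (hK : 1 ≤ K) (k : ℕ) (hk : 1 ≤ k)
    (h : n.factorial * k ≤ ∏ i ∈ Finset.range n, (K + i)) :
    ((n.factorial * k : ℕ) : ℝ) ^ ((2 : ℝ) / n) - ((n : ℝ) - 1) * ((n : ℝ) - 2) / 6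
      ≤ (K : ℝ) * ((K : ℝ) + n - 1) := by
  have hle : ((n.factorial * k : ℕ) : ℝ) ≤ ∏ i ∈ Finset.range n, ((K : ℝ) + i) := by
    exact_mod_cast h
  have hpow := Real.rpow_le_rpow (Nat.cast_nonneg _) hle (by positivity : (0 : ℝ) ≤ 2 / n)
  linarith [prod_range_add_rpow_le n (by lia) (Nat.cast_nonneg (α := ℝ) K)]
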